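/- Let v1 ∈ C²(B_{R0}) ∩ C(closure B_{R0}) satisfy (ε + |y|²) Δv1(y) + 2⟨y, ∇v1(y)⟩ − (2/γ) v1(y) = 0 for all y ∈ B_{R0} ⊂ ℝ^{n−1}. Then for all 0 < ρ < R ≤ R0, ( ⨍_{∂B_ρ} |v1 − (v1)_{∂B_ρ}|² )^{1/2} ≤ (ρ/R)^{α̂} · ( ⨍_{∂B_R} |v1 − (v1)_{∂B_R}|² )^{1/2}. -/

import Mathlib

open MeasureTheory Metric Set
open scoped RealInnerProductSpace ENNReal

noncomputable section

abbrev E (k : ℕ) := EuclideanSpace ℝ (Fin k)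

/-- Laplacian: sum of pure second directional derivatives. -/
def elap {k : ℕ} (u : E k → ℝ) (x : E k) : ℝ :=
  ∑ i : Fin k, iteratedFDeriv ℝ 2 u x ![EuclideanSpace.single i 1, EuclideanSpace.single i 1]

/-- Average of `w` over the sphere `∂B_ρ ⊂ ℝ^m`, with respect to
`(m-1)`-dimensional Hausdorff measure. -/
def sAvg {m : ℕ} (ρ : ℝ) (w : E m → ℝ) : ℝ :=
  ⨍ x in sphere (0 : E m) ρ, w x ∂(μH[(m:ℝ) - 1])

/-- The mean-square deviation `( ⨍_{∂B_ρ} |w - (w)_{∂B_ρ}|² )^{1/2}`. -/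
def sDev {m : ℕ} (ρ : ℝ) (w : E m → ℝ) : ℝ :=
  Real.sqrt (⨍ x in sphere (0 : E m) ρ, (w x - sAvg ρ w)^2 ∂(μH[(m:ℝ) - 1]))

/-- Divergence of a vector field on `ℝ^m`. -/
def divg {m : ℕ} (F : E m → E m) (y : E m) : ℝ :=
  ∑ i : Fin m, (fderiv ℝ F y (EuclideanSpace.single i 1)) i

open MvPolynomial in
/-- The infinitesimal rotation `X i ∂ⱼ - X j ∂ᵢ` acting on polynomials. -/
def polyRot {m : ℕ} (i j : Fin m) :
    Derivation ℝ (MvPolynomial (Fin m) ℝ) (MvPolynomial (Fin m) ℝ) :=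
  (X i : MvPolynomial (Fin m) ℝ) • pderiv j - (X j : MvPolynomial (Fin m) ℝ) • pderiv i

/-- Twice the spherical Laplacian acting on polynomials. -/
def polySphLap {m : ℕ} : MvPolynomial (Fin m) ℝ →ₗ[ℝ] MvPolynomial (Fin m) ℝ :=
  ∑ i : Fin m, ∑ j : Fin m, (polyRot i j).toLinearMap ∘ₗ (polyRot i j).toLinearMap

/-- The polynomial `∑ i, X i ^ 2`. -/
def normSqPoly (m : ℕ) : MvPolynomial (Fin m) ℝ := ∑ i, MvPolynomial.X i ^ 2

/-- The Laplacian of a polynomial. -/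
def polyLap {m : ℕ} (p : MvPolynomial (Fin m) ℝ) : MvPolynomial (Fin m) ℝ :=
  ∑ i, MvPolynomial.pderiv i (MvPolynomial.pderiv i p)

namespace MvPolynomial

variable {m : ℕ}

lemma polyRot_apply (i j : Fin m) (p : MvPolynomial (Fin m) ℝ) :
    polyRot i j p = X i * pderiv j p - X j * pderiv i p := by
  simp [polyRot]

lemma polySphLap_apply (p : MvPolynomial (Fin m) ℝ) :
    polySphLap p = ∑ i, ∑ j, polyRot i j (polyRot i j p) := by
  simp [polySphLap]

lemma polyRot_normSqPoly (i j : Fin m) : polyRot i j (normSqPoly m) = 0 := by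
  have h : ∀ k : Fin m, pderiv k (normSqPoly m) = 2 * X k := by
    intro k
    simp only [normSqPoly, map_sum, pderiv_pow, pderiv_X]
    rw [Finset.sum_eq_single k]
    · simp
    · intro b _ hb
      simp [hb.symm]
    · simp
  rw [polyRot_apply, h, h]
  ring

lemma polySphLap_normSqPoly_mul (p : MvPolynomial (Fin m) ℝ) :
    polySphLap (normSqPoly m * p) = normSqPoly m * polySphLap p := by
  simp [polySphLap_apply, Derivation.leibniz, polyRot_normSqPoly, Finset.mul_sum]

lemma polySphLap_eq (p : MvPolynomial (Fin m) ℝ) :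
    polySphLap p = 2 * (normSqPoly m * polyLap p
      - ∑ i, ∑ j, X i * (X j * pderiv i (pderiv j p))
      - ((m : MvPolynomial (Fin m) ℝ) - 1) * ∑ i, X i * pderiv i p) := by
  have hterm : ∀ i j : Fin m, polyRot i j (polyRot i j p) =
      (if i = j then X i * pderiv j p else 0) + (if i = j then X j * pderiv i p else 0)
      + X i ^ 2 * pderiv j (pderiv j p) + X j ^ 2 * pderiv i (pderiv i p)
      - X i * pderiv i p - X j * pderiv j p
      - X i * (X j * pderiv j (pderiv i p)) - X i * (X j * pderiv i (pderiv j p)) := by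
    intro i j
    simp only [polyRot_apply, map_sub, pderiv_mul, pderiv_X]
    by_cases h : i = j
    · subst h
      simp
      ring
    · simp [h, Ne.symm h]
      ring
  have hswap : ∑ i : Fin m, ∑ j : Fin m, X i * (X j * pderiv j (pderiv i p))
      = ∑ i : Fin m, ∑ j : Fin m, X i * (X j * pderiv i (pderiv j p)) := by
    rw [Finset.sum_comm]
    refine Finset.sum_congr rfl fun i _ => Finset.sum_congr rfl fun j _ => by ring
  have hsq : ∑ i : Fin m, ∑ j : Fin m, X i ^ 2 * pderiv j (pderiv j p)
      = normSqPoly m * polyLap p := by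
    simp [normSqPoly, polyLap, Finset.sum_mul_sum]
  have hsq' : ∑ i : Fin m, ∑ j : Fin m, X j ^ 2 * pderiv i (pderiv i p)
      = normSqPoly m * polyLap p := by
    rw [Finset.sum_comm, hsq]
  rw [polySphLap_apply]
  simp only [hterm, Finset.sum_add_distrib, Finset.sum_sub_distrib, hsq, hsq', hswap]
  simp only [Finset.sum_ite_eq, Finset.mem_univ, if_true, Finset.sum_const, Finset.card_univ,
    Fintype.card_fin, nsmul_eq_mul, ← Finset.mul_sum]
  ring

lemma IsHomogeneous.polyLap {p : MvPolynomial (Fin m) ℝ} {d : ℕ} (hp : p.IsHomogeneous d) :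
    (polyLap p).IsHomogeneous (d - 2) := by
  refine IsHomogeneous.sum _ _ _ fun i _ => ?_
  have := (hp.pderiv (i := i)).pderiv (i := i)
  rwa [Nat.sub_sub] at this

lemma IsHomogeneous.polySphLap_eq {p : MvPolynomial (Fin m) ℝ} {d : ℕ}
    (hp : p.IsHomogeneous d) :
    polySphLap p = (2 : ℝ) • (normSqPoly m * _root_.polyLap p)
      - (2 * ((d : ℝ) * (d + m - 2))) • p := by
  have h2 : ∑ i : Fin m, ∑ j : Fin m, X i * (X j * pderiv i (pderiv j p))
      = ((d : MvPolynomial (Fin m) ℝ) * (d - 1)) * p := by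
    have hj : ∀ j : Fin m, ∑ i : Fin m, X i * (X j * pderiv i (pderiv j p))
        = ((d : MvPolynomial (Fin m) ℝ) - 1) * (X j * pderiv j p) := by
      intro j
      have h := (hp.pderiv (i := j)).sum_X_mul_pderiv
      rcases d with _ | d
      · have h0 : pderiv j p = 0 := by
          rw [(totalDegree_eq_zero_iff_eq_C (p := p)).1 (by simpa using hp.totalDegree_le)]
          simp
        simp [h0]
      · calc ∑ i : Fin m, X i * (X j * pderiv i (pderiv j p))
            = X j * ∑ i : Fin m, X i * pderiv i (pderiv j p) := by
              rw [Finset.mul_sum]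
              exact Finset.sum_congr rfl fun i _ => by ring
          _ = _ := by
              rw [h]
              simp
              ring
    rw [Finset.sum_comm]
    simp only [hj]
    rw [← Finset.mul_sum, hp.sum_X_mul_pderiv]
    simp
    ring
  rw [MvPolynomial.polySphLap_eq, h2, hp.sum_X_mul_pderiv]
  simp only [smul_eq_C_mul, map_mul, map_add, map_sub, map_natCast, nsmul_eq_mul, map_ofNat]
  ring

/-- The polynomial is constant on every sphere centred at the origin. -/
def IsRadial (p : MvPolynomial (Fin m) ℝ) : Prop :=
  ∃ c : ℝ, ∀ x : E m, ‖x‖ = 1 → eval (fun i => x i) p = c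

lemma eval_normSqPoly (x : E m) : eval (fun i => x i) (normSqPoly m) = ‖x‖ ^ 2 := by
  simp [normSqPoly, EuclideanSpace.norm_sq_eq]

lemma IsHomogeneous.exists_eigen_decomp (hm : 1 ≤ m) :
    ∀ (d : ℕ) (p : MvPolynomial (Fin m) ℝ), p.IsHomogeneous d →
      ∃ h : ℕ → MvPolynomial (Fin m) ℝ,
        (∀ k : ℕ, polySphLap (h k) = -(2 * ((k : ℝ) * (k + m - 2))) • h k) ∧
        IsRadial (h 0) ∧ p = ∑ k ∈ Finset.range (d + 1), h k := by
  intro d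
  induction d using Nat.strong_induction_on with
  | _ d ih =>
  intro p hp
  have hD := hp.polySphLap_eq
  have hm' : (1 : ℝ) ≤ m := by exact_mod_cast hm
  by_cases hd : d < 2
  · have hL : _root_.polyLap p = 0 := by
      refine Finset.sum_eq_zero fun i _ => ?_
      have h1 := hp.pderiv (i := i)
      rw [(totalDegree_eq_zero_iff_eq_C (p := pderiv i p)).1
        (Nat.le_zero.1 (h1.totalDegree_le.trans (by omega)))]
      simp
    rw [hL] at hD
    refine ⟨Function.update 0 d p, fun k => ?_, ?_, ?_⟩
    · by_cases hk : k = d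
      · subst hk
        simp [hD]
      · simp [hk]
    · by_cases hk : 0 = d
      · subst hk
        refine ⟨coeff 0 p, fun x _ => ?_⟩
        rw [Function.update_self, (totalDegree_eq_zero_iff_eq_C (p := p)).1
          (Nat.le_zero.1 hp.totalDegree_le)]
        simp
      · exact ⟨0, fun x _ => by simp [hk]⟩
    · rw [Finset.sum_eq_single d]
      · simp
      · intro b _ hb
        simp [hb]
      · simp
  · push Not at hd
    obtain ⟨h, hh, ⟨c, hc⟩, hsum⟩ := ih (d - 2) (by omega) _ hp.polyLap
    set μ : ℕ → ℝ := fun k => 2 * ((k : ℝ) * (k + m - 2)) with hμ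
    have hne : ∀ k ∈ Finset.range (d - 2 + 1), μ d - μ k ≠ 0 := by
      intro k hk
      have hk' : k + 2 ≤ d := by
        have := Finset.mem_range.1 hk
        omega
      have hk'' : (k : ℝ) + 2 ≤ d := by exact_mod_cast hk'
      have : (0 : ℝ) ≤ k := Nat.cast_nonneg k
      have : μ d - μ k = 2 * ((d - k) * (d + k + m - 2)) := by simp only [hμ]; ring
      rw [this]
      have : (0 : ℝ) < (d - k) * (d + k + m - 2) := mul_pos (by linarith) (by linarith)
      positivity
    set g : ℕ → MvPolynomial (Fin m) ℝ := fun k => (2 / (μ d - μ k)) • (normSqPoly m * h k)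
      with hg
    have hgD : ∀ k, polySphLap (g k) = -(μ k) • g k := by
      intro k
      simp only [hg, map_smul, polySphLap_normSqPoly_mul, hh]
      rw [mul_smul_comm, smul_comm]
    set s := ∑ k ∈ Finset.range (d - 2 + 1), g k with hs
    have htop : polySphLap (p - s) = -(μ d) • (p - s) := by
      have e1 : (2 : ℝ) • (normSqPoly m * _root_.polyLap p)
          = ∑ k ∈ Finset.range (d - 2 + 1), (μ d - μ k) • g k := by
        rw [hsum, Finset.mul_sum, Finset.smul_sum]
        refine Finset.sum_congr rfl fun k hk => ?_
        simp only [hg]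
        rw [smul_smul, mul_div_cancel₀ _ (hne k hk)]
      have e2 : polySphLap s = ∑ k ∈ Finset.range (d - 2 + 1), -(μ k) • g k := by
        rw [hs, map_sum]
        exact Finset.sum_congr rfl fun k _ => hgD k
      have e3 : μ d • s = ∑ k ∈ Finset.range (d - 2 + 1), μ d • g k := by
        rw [hs, Finset.smul_sum]
      have e4 : (∑ k ∈ Finset.range (d - 2 + 1), (μ d - μ k) • g k)
          = μ d • s + ∑ k ∈ Finset.range (d - 2 + 1), -(μ k) • g k := by
        rw [e3, ← Finset.sum_add_distrib]
        exact Finset.sum_congr rfl fun k _ => by rw [← add_smul, sub_eq_add_neg]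
      rw [map_sub, hD, e1, e2, e4, smul_sub]
      module
    refine ⟨fun k => if k < d - 2 + 1 then g k else if k = d then p - s else 0, fun k => ?_, ?_, ?_⟩
    · dsimp only
      split_ifs with h1 h2
      · exact hgD k
      · subst h2
        exact htop
      · simp
    · refine ⟨2 / (μ d - μ 0) * c, fun x hx => ?_⟩
      have := eval_normSqPoly x
      simp [hg, smul_eval, this, hx, hc x hx]
    · rw [Finset.sum_range_succ, show d = d - 2 + 1 + 1 by omega, Finset.sum_range_succ,
        show d - 2 + 1 + 1 - 2 + 1 = d - 2 + 1 by omega]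
      rw [show d - 2 + 1 + 1 = d by omega]
      rw [Finset.sum_congr rfl (g := g) fun k hk => if_pos (Finset.mem_range.1 hk)]
      simp [← hs, show ¬ (d - 2 + 1 = d) by omega, show ¬ (d < d - 2 + 1) by omega]

lemma exists_eigen_decomp (hm : 1 ≤ m) (p : MvPolynomial (Fin m) ℝ) :
    ∃ (N : ℕ) (h : ℕ → MvPolynomial (Fin m) ℝ),
      (∀ k : ℕ, polySphLap (h k) = -(2 * ((k : ℝ) * (k + m - 2))) • h k) ∧
      IsRadial (h 0) ∧ p = ∑ k ∈ Finset.range (N + 1), h k := by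
  choose h hh hr hs using fun d => IsHomogeneous.exists_eigen_decomp hm d _
    (homogeneousComponent_isHomogeneous d p)
  refine ⟨p.totalDegree, fun k => ∑ d ∈ Finset.range (p.totalDegree + 1),
    if k < d + 1 then h d k else 0, fun k => ?_, ?_, ?_⟩
  · rw [map_sum, Finset.smul_sum]
    refine Finset.sum_congr rfl fun d _ => ?_
    split_ifs
    · exact hh d k
    · simp
  · choose c hc using hr
    refine ⟨∑ d ∈ Finset.range (p.totalDegree + 1), c d, fun x hx => ?_⟩
    simp [hc _ x hx]
  · rw [Finset.sum_comm]
    conv_lhs => rw [← sum_homogeneousComponent p]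
    refine Finset.sum_congr rfl fun d hd => ?_
    rw [hs d, ← Finset.sum_filter]
    refine Finset.sum_congr ?_ fun _ _ => rfl
    ext k
    have := Finset.mem_range.1 hd
    simp only [Finset.mem_range, Finset.mem_filter]
    omega

end MvPolynomial
lemma IsLocalMax.second_deriv_nonpos {h h' : ℝ → ℝ} {h'' r : ℝ}
    (hmax : IsLocalMax h r) (hd : ∀ᶠ s in nhds r, HasDerivAt h (h' s) s)
    (hd' : HasDerivAt h' h'' r) : h'' ≤ 0 := by
  by_contra! hpos
  have hderiv : deriv h =ᶠ[nhds r] h' := hd.mono fun s hs => hs.deriv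
  have h2 : deriv (deriv h) r = h'' := by rw [hderiv.deriv_eq, hd'.deriv]
  have hmin : IsLocalMin h r := isLocalMin_of_deriv_deriv_pos (h2 ▸ hpos) hmax.deriv_eq_zero
    hd.self_of_nhds.continuousAt
  have hconst : h =ᶠ[nhds r] fun _ => h r := by
    filter_upwards [hmax, hmin] with s h1 h2 using le_antisymm h1 h2
  have hz : deriv h =ᶠ[nhds r] fun _ => 0 := by
    filter_upwards [hconst.eventuallyEq_nhds] with s hs
    rw [hs.deriv_eq, deriv_const]
  rw [hz.deriv_eq, deriv_const] at h2
  linarith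

/-- The function `r ↦ r ^ a` is a supersolution of the radial equation. -/
lemma radial_supersolution_ineq {m γ ε lam a r : ℝ} (hm : 1 ≤ m) (hγ : 0 < γ) (hε : 0 < ε)
    (hlam : m - 1 ≤ lam)
    (ha : a = min ((-m + Real.sqrt (m ^ 2 + 4 * (m - 1 + 2 / γ))) / 2) 1) :
    0 < a ∧ (ε + r ^ 2) * (a * (a - 1) + (m - 1) * a) + 2 * r ^ 2 * a
      ≤ lam * (ε + r ^ 2) + 2 / γ * r ^ 2 := by
  have hγ' : 0 < 2 / γ := by positivity
  set s := Real.sqrt (m ^ 2 + 4 * (m - 1 + 2 / γ)) with hs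
  have hs2 : s ^ 2 = m ^ 2 + 4 * (m - 1 + 2 / γ) := Real.sq_sqrt (by nlinarith)
  have hs0 : 0 ≤ s := Real.sqrt_nonneg _
  have hsm : m < s := by
    by_contra! h
    nlinarith
  have ha0 : 0 < a := by
    rw [ha]
    exact lt_min (by linarith) one_pos
  have ha1 : a ≤ 1 := ha ▸ min_le_right _ _
  have has : 2 * a + m ≤ s := by
    have : a ≤ (-m + s) / 2 := ha ▸ min_le_left _ _
    linarith
  refine ⟨ha0, ?_⟩
  have h1 : (2 * a + m) ^ 2 ≤ s ^ 2 := by gcongr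
  have h2 : a ^ 2 + m * a ≤ m - 1 + 2 / γ := by nlinarith
  have h3 : (a - 1) * (a + m - 1) ≤ 0 := mul_nonpos_of_nonpos_of_nonneg (by linarith) (by linarith)
  have h4 : 0 ≤ (lam - (m - 1)) * (ε + r ^ 2) := mul_nonneg (by linarith) (by positivity)
  nlinarith [mul_le_mul_of_nonneg_left h2 (sq_nonneg r), mul_nonneg hε.le (neg_nonneg.2 h3)]

lemma radial_le {V V' V'' : ℝ → ℝ} {m γ ε lam a R ρ : ℝ} (hm : 1 ≤ m) (hγ : 0 < γ) (hε : 0 < ε)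
    (hlam : m - 1 ≤ lam)
    (ha : a = min ((-m + Real.sqrt (m ^ 2 + 4 * (m - 1 + 2 / γ))) / 2) 1)
    (hV : ContinuousOn V (Icc 0 R)) (hV0 : V 0 = 0)
    (hd : ∀ r ∈ Ioo 0 R, HasDerivAt V (V' r) r) (hd' : ∀ r ∈ Ioo 0 R, HasDerivAt V' (V'' r) r)
    (hode : ∀ r ∈ Ioo 0 R, (ε + r ^ 2) * (r ^ 2 * V'' r + (m - 1) * (r * V' r) - lam * V r)
      + 2 * r ^ 2 * (r * V' r) - 2 / γ * r ^ 2 * V r = 0)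
    (hρ : ρ ∈ Ioo 0 R) : V ρ ≤ (ρ / R) ^ a * |V R| := by
  have hγ' : 0 < 2 / γ := by positivity
  have hR : 0 < R := hρ.1.trans hρ.2
  have ha0 : 0 < a := (radial_supersolution_ineq (r := 0) hm hγ hε hlam ha).1
  set c := |V R| / R ^ a with hc
  have hc0 : 0 ≤ c := by positivity
  have hcR : c * R ^ a = |V R| := div_mul_cancel₀ _ (Real.rpow_pos_of_pos hR a).ne'
  suffices h : V ρ ≤ c * ρ ^ a by
    refine h.trans_eq ?_
    rw [hc, Real.div_rpow hρ.1.le hR.le]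
    ring
  by_contra! hlt
  set h : ℝ → ℝ := fun r => V r - c * r ^ a with hh
  have hcont : ContinuousOn h (Icc 0 R) :=
    hV.sub (continuousOn_const.mul (Real.continuous_rpow_const ha0.le).continuousOn)
  obtain ⟨r, hr, hmax⟩ := isCompact_Icc.exists_isMaxOn ⟨ρ, hρ.1.le, hρ.2.le⟩ hcont
  have hpos : 0 < h r := by
    have h1 : h ρ ≤ h r := hmax ⟨hρ.1.le, hρ.2.le⟩
    have h2 : 0 < h ρ := sub_pos.2 hlt
    exact h2.trans_le h1
  have hr0 : r ≠ 0 := by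
    rintro rfl
    simp [hh, hV0, Real.zero_rpow ha0.ne'] at hpos
  have hrR : r ≠ R := by
    rintro rfl
    simp only [hh, hcR] at hpos
    linarith [le_abs_self (V r)]
  have hrI : r ∈ Ioo 0 R := ⟨hr.1.lt_of_ne hr0.symm, hr.2.lt_of_ne hrR⟩
  have hlm : IsLocalMax h r := hmax.isLocalMax (Icc_mem_nhds hrI.1 hrI.2)
  have hdh : ∀ s ∈ Ioo 0 R, HasDerivAt h (V' s - c * (a * s ^ (a - 1))) s := fun s hs =>
    (hd s hs).sub ((Real.hasDerivAt_rpow_const (Or.inl hs.1.ne')).const_mul c)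
  have hdh' : HasDerivAt (fun s => V' s - c * (a * s ^ (a - 1)))
      (V'' r - c * (a * ((a - 1) * r ^ (a - 1 - 1)))) r :=
    (hd' r hrI).sub (((Real.hasDerivAt_rpow_const (Or.inl hrI.1.ne')).const_mul a).const_mul c)
  have h2 := hlm.second_deriv_nonpos
    (Filter.eventually_of_mem (Ioo_mem_nhds hrI.1 hrI.2) hdh) hdh'
  have h1 : V' r - c * (a * r ^ (a - 1)) = 0 := hlm.hasDerivAt_eq_zero (hdh r hrI)
  have e1 : r * r ^ (a - 1) = r ^ a := by
    rw [Real.rpow_sub_one hr0]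
    field_simp
  have e2 : r ^ 2 * r ^ (a - 1 - 1) = r ^ a := by
    rw [Real.rpow_sub_one hr0, Real.rpow_sub_one hr0]
    field_simp
  have hP : 0 ≤ c * r ^ a := mul_nonneg hc0 (Real.rpow_nonneg hr.1 a)
  have hV' : r * V' r = a * (c * r ^ a) := by
    rw [sub_eq_zero.1 h1, ← e1]
    ring
  have hV'' : r ^ 2 * V'' r ≤ a * (a - 1) * (c * r ^ a) := by
    have h3 := mul_le_mul_of_nonneg_left (sub_nonpos.1 h2) (sq_nonneg r)
    refine h3.trans_eq ?_
    rw [← e2]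
    ring
  have hVr : c * r ^ a < V r := sub_pos.1 hpos
  have hineq := (radial_supersolution_ineq (r := r) hm hγ hε hlam ha).2
  have hode' := hode r hrI
  rw [hV'] at hode'
  have hcoef : 0 < lam * (ε + r ^ 2) + 2 / γ * r ^ 2 := by
    have := pow_pos hrI.1 2
    have : 0 ≤ lam * (ε + r ^ 2) := mul_nonneg (by linarith) (by positivity)
    positivity
  have k1 := mul_lt_mul_of_pos_left hVr hcoef
  have k2 := mul_le_mul_of_nonneg_right hineq hP
  have k3 := mul_le_mul_of_nonneg_left hV'' (show 0 ≤ ε + r ^ 2 by positivity)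
  linarith

lemma radial_decay {V V' V'' : ℝ → ℝ} {m γ ε lam a R ρ : ℝ} (hm : 1 ≤ m) (hγ : 0 < γ)
    (hε : 0 < ε) (hlam : m - 1 ≤ lam)
    (ha : a = min ((-m + Real.sqrt (m ^ 2 + 4 * (m - 1 + 2 / γ))) / 2) 1)
    (hV : ContinuousOn V (Icc 0 R)) (hV0 : V 0 = 0)
    (hd : ∀ r ∈ Ioo 0 R, HasDerivAt V (V' r) r) (hd' : ∀ r ∈ Ioo 0 R, HasDerivAt V' (V'' r) r)
    (hode : ∀ r ∈ Ioo 0 R, (ε + r ^ 2) * (r ^ 2 * V'' r + (m - 1) * (r * V' r) - lam * V r)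
      + 2 * r ^ 2 * (r * V' r) - 2 / γ * r ^ 2 * V r = 0)
    (hρ : ρ ∈ Ioo 0 R) : |V ρ| ≤ (ρ / R) ^ a * |V R| := by
  refine abs_le'.2 ⟨radial_le hm hγ hε hlam ha hV hV0 hd hd' hode hρ, ?_⟩
  have := radial_le (V := fun r => -V r) (V' := fun r => -V' r) (V'' := fun r => -V'' r)
    hm hγ hε hlam ha hV.neg (by simp [hV0]) (fun r hr => (hd r hr).neg)
    (fun r hr => (hd' r hr).neg) (fun r hr => by linarith [hode r hr]) hρ
  simpa using this
/-- A rotation invariant probability measure on the unit sphere. -/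
structure IsRotInvSphere {m : ℕ} (ν : Measure (E m)) : Prop where
  isProb : IsProbabilityMeasure ν
  ae_mem : ∀ᵐ x ∂ν, x ∈ sphere (0 : E m) 1
  map_eq : ∀ e : E m ≃ₗᵢ[ℝ] E m, MeasurePreserving e ν ν

namespace IsRotInvSphere

variable {m : ℕ} {ν : Measure (E m)}

lemma restrict_eq (hν : IsRotInvSphere ν) : ν.restrict (sphere 0 1) = ν :=
  Measure.restrict_eq_self_of_ae_mem hν.ae_mem

lemma integrable (hν : IsRotInvSphere ν) {f : E m → ℝ} (hf : ContinuousOn f (sphere 0 1)) :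
    Integrable f ν := by
  have := hν.isProb
  have h := hf.integrableOn_compact (μ := ν) (isCompact_sphere 0 1)
  rwa [IntegrableOn, hν.restrict_eq] at h

lemma integral_congr (hν : IsRotInvSphere ν) {f g : E m → ℝ}
    (h : ∀ x ∈ sphere (0 : E m) 1, f x = g x) : ∫ x, f x ∂ν = ∫ x, g x ∂ν :=
  integral_congr_ae (hν.ae_mem.mono h)

lemma hasDerivAt_integral (hν : IsRotInvSphere ν) {U : Set ℝ} (hU : IsOpen U) {t : ℝ} (ht : t ∈ U)
    {G G' : ℝ → E m → ℝ} (hG : ∀ s ∈ U, ContinuousOn (G s) (sphere 0 1))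
    (hG' : ContinuousOn (fun q : ℝ × E m => G' q.1 q.2) (U ×ˢ sphere 0 1))
    (hd : ∀ s ∈ U, ∀ x ∈ sphere (0 : E m) 1, HasDerivAt (fun s => G s x) (G' s x) s) :
    HasDerivAt (fun s => ∫ x, G s x ∂ν) (∫ x, G' t x ∂ν) t := by
  obtain ⟨δ, hδ, hsub⟩ := Metric.nhds_basis_closedBall.mem_iff.1 (hU.mem_nhds ht)
  have hcpt : IsCompact (closedBall t δ ×ˢ sphere (0 : E m) 1) :=
    (isCompact_closedBall t δ).prod (isCompact_sphere 0 1)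
  obtain ⟨C, hC⟩ := hcpt.exists_bound_of_continuousOn (hG'.mono (prod_mono hsub subset_rfl))
  have hG't : ContinuousOn (G' t) (sphere 0 1) :=
    hG'.comp (f := fun x : E m => (t, x)) (by fun_prop) fun x hx => ⟨ht, hx⟩
  have := hν.isProb
  refine (hasDerivAt_integral_of_dominated_loc_of_deriv_le (bound := fun _ => C)
    (closedBall_mem_nhds t hδ) ?_ (hν.integrable (hG t ht))
    (hν.integrable hG't).aestronglyMeasurable ?_ (integrable_const C) ?_).2
  · filter_upwards [hU.mem_nhds ht] with s hs using (hν.integrable (hG s hs)).aestronglyMeasurable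
  · filter_upwards [hν.ae_mem] with x hx s hs using hC (s, x) ⟨hs, hx⟩
  · filter_upwards [hν.ae_mem] with x hx s hs using hd s (hsub hs) x hx

lemma abs_integral_mul_le (hν : IsRotInvSphere ν) {f g : E m → ℝ}
    (hf : ContinuousOn f (sphere 0 1)) (hg : ContinuousOn g (sphere 0 1)) :
    |∫ x, f x * g x ∂ν| ≤ Real.sqrt (∫ x, f x ^ 2 ∂ν) * Real.sqrt (∫ x, g x ^ 2 ∂ν) := by
  have hff : Integrable (fun x => f x ^ 2) ν := hν.integrable (hf.pow 2)
  have hgg : Integrable (fun x => g x ^ 2) ν := hν.integrable (hg.pow 2)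
  have hfg : Integrable (fun x => f x * g x) ν := hν.integrable (hf.mul hg)
  have key : ∀ t : ℝ, 0 ≤ (∫ x, g x ^ 2 ∂ν) * (t * t) + (2 * ∫ x, f x * g x ∂ν) * t
      + ∫ x, f x ^ 2 ∂ν := by
    intro t
    have h0 : 0 ≤ ∫ x, (f x + t * g x) ^ 2 ∂ν := integral_nonneg fun x => sq_nonneg _
    have h1 : ∫ x, (f x + t * g x) ^ 2 ∂ν
        = ∫ x, (g x ^ 2 * (t * t) + f x * g x * (2 * t) + f x ^ 2) ∂ν :=
      integral_congr_ae (Filter.Eventually.of_forall fun x => by simp only; ring)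
    have hi : Integrable (fun x => g x ^ 2 * (t * t) + f x * g x * (2 * t)) ν :=
      (hgg.mul_const _).add (hfg.mul_const _)
    rw [h1, integral_add hi hff, integral_add (hgg.mul_const _) (hfg.mul_const _),
      integral_mul_const, integral_mul_const] at h0
    linarith
  have hd := discrim_le_zero key
  rw [discrim] at hd
  rw [← Real.sqrt_mul (integral_nonneg fun x => sq_nonneg _)]
  refine Real.abs_le_sqrt ?_
  linarith

end IsRotInvSphere
/-- The generator `x ↦ x i • e j - x j • e i` of the rotations in the `(i, j)`-plane. -/
def rotGen {m : ℕ} (i j : Fin m) : E m →L[ℝ] E m :=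
  (EuclideanSpace.proj i : E m →L[ℝ] ℝ).smulRight (EuclideanSpace.single j (1 : ℝ)) -
    (EuclideanSpace.proj j : E m →L[ℝ] ℝ).smulRight (EuclideanSpace.single i (1 : ℝ))

/-- The derivative of `f` along the rotations in the `(i, j)`-plane. -/
def rotDeriv {m : ℕ} (i j : Fin m) (f : E m → ℝ) (x : E m) : ℝ := fderiv ℝ f x (rotGen i j x)

/-- Twice the spherical Laplacian. -/
def sphLap {m : ℕ} (f : E m → ℝ) (x : E m) : ℝ :=
  ∑ i : Fin m, ∑ j : Fin m, rotDeriv i j (rotDeriv i j f) x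

section Rotation

variable {m : ℕ}

lemma rotGen_apply (i j : Fin m) (x : E m) :
    rotGen i j x
      = x i • EuclideanSpace.single j (1 : ℝ) - x j • EuclideanSpace.single i (1 : ℝ) := by
  simp [rotGen]

lemma inner_rotGen (i j : Fin m) (x y : E m) : ⟪x, rotGen i j y⟫ = -⟪rotGen i j x, y⟫ := by
  simp only [rotGen_apply, inner_sub_left, inner_sub_right, inner_smul_left, inner_smul_right,
    EuclideanSpace.inner_single_left, EuclideanSpace.inner_single_right]
  simp
  ring

lemma rotGen_rotGen_rotGen (i j : Fin m) (x : E m) :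
    rotGen i j (rotGen i j (rotGen i j x)) = -rotGen i j x := by
  by_cases h : i = j
  · subst h
    simp [rotGen_apply]
  · simp [rotGen_apply, h, Ne.symm h]
    abel

lemma norm_sq_planeRotation (i j : Fin m) (t : ℝ) (x : E m) :
    ‖x + Real.sin t • rotGen i j x + (1 - Real.cos t) • rotGen i j (rotGen i j x)‖ ^ 2
      = ‖x‖ ^ 2 := by
  set A := rotGen i j
  have h1 : ⟪x, A x⟫ = 0 := by
    have := inner_rotGen i j x x
    rw [real_inner_comm] at this
    linarith [real_inner_comm (A x) x]
  have h2 : ⟪x, A (A x)⟫ = -⟪A x, A x⟫ := inner_rotGen i j x (A x)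
  have h3 : ⟪A x, A (A x)⟫ = 0 := by
    have := inner_rotGen i j (A x) (A x)
    linarith [real_inner_comm (A (A x)) (A x)]
  have h4 : ⟪A (A x), A (A x)⟫ = ⟪A x, A x⟫ := by
    rw [inner_rotGen i j (A (A x)) (A x)]
    rw [show rotGen i j (A (A x)) = -A x from rotGen_rotGen_rotGen i j x, inner_neg_left, neg_neg]
  rw [← real_inner_self_eq_norm_sq, ← real_inner_self_eq_norm_sq]
  simp only [inner_add_left, inner_add_right, inner_smul_left, inner_smul_right,
    real_inner_comm x, real_inner_comm (A x) (A (A x)), h1, h2, h3, h4]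
  simp only [conj_trivial]
  linear_combination ⟪A x, A x⟫ * Real.sin_sq_add_cos_sq t

/-- The rotation by the angle `t` in the `(i, j)`-plane (the identity if `i = j`). -/
def planeRotation (i j : Fin m) (t : ℝ) : E m ≃ₗᵢ[ℝ] E m :=
  LinearIsometry.toLinearIsometryEquiv
    { toLinearMap := LinearMap.id + Real.sin t • (rotGen i j).toLinearMap +
        (1 - Real.cos t) • ((rotGen i j).toLinearMap ∘ₗ (rotGen i j).toLinearMap)
      norm_map' := fun x => by
        rw [← sq_eq_sq₀ (norm_nonneg _) (norm_nonneg _)]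
        exact norm_sq_planeRotation i j t x } rfl

lemma planeRotation_apply (i j : Fin m) (t : ℝ) (x : E m) :
    planeRotation i j t x
      = x + Real.sin t • rotGen i j x + (1 - Real.cos t) • rotGen i j (rotGen i j x) :=
  rfl

lemma hasDerivAt_planeRotation (i j : Fin m) (t : ℝ) (x : E m) :
    HasDerivAt (fun s => planeRotation i j s x)
      (Real.cos t • rotGen i j x + Real.sin t • rotGen i j (rotGen i j x)) t := by
  simp only [planeRotation_apply]
  have h1 := (Real.hasDerivAt_sin t).smul_const (rotGen i j x)
  have h2 := ((Real.hasDerivAt_cos t).const_sub 1).smul_const (rotGen i j (rotGen i j x))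
  rw [neg_neg] at h2
  exact (h1.const_add x).add h2

lemma IsRotInvSphere.integral_rotDeriv {ν : Measure (E m)} (hν : IsRotInvSphere ν) {U : Set (E m)}
    (hU : IsOpen U) (hsub : sphere 0 1 ⊆ U) {F : E m → ℝ} (hF : ContDiffOn ℝ 1 F U)
    (i j : Fin m) : ∫ x, rotDeriv i j F x ∂ν = 0 := by
  have hmem : ∀ (t : ℝ) (x : E m), x ∈ sphere (0 : E m) 1 →
      planeRotation i j t x ∈ sphere (0 : E m) 1 := by
    intro t x hx
    simpa using hx
  have hrot : Continuous fun q : ℝ × E m => planeRotation i j q.1 q.2 := by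
    simp only [planeRotation_apply]
    fun_prop
  have h := hν.hasDerivAt_integral (t := 0) isOpen_univ (mem_univ _)
    (G := fun t x => F (planeRotation i j t x))
    (G' := fun t x => fderiv ℝ F (planeRotation i j t x)
      (Real.cos t • rotGen i j x + Real.sin t • rotGen i j (rotGen i j x)))
    (fun s _ => hF.continuousOn.comp (planeRotation i j s).continuous.continuousOn
      fun x hx => hsub (hmem s x hx)) ?_ ?_
  · have hconst : (fun s => ∫ x, F (planeRotation i j s x) ∂ν) = fun _ => ∫ x, F x ∂ν := by
      funext s
      exact (hν.map_eq (planeRotation i j s)).integral_comp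
        (planeRotation i j s).toHomeomorph.measurableEmbedding F
    rw [hconst] at h
    have h0 := h.unique (hasDerivAt_const _ _)
    simpa [planeRotation_apply, rotDeriv] using h0
  · refine ContinuousOn.clm_apply ?_ (by fun_prop)
    exact (hF.continuousOn_fderiv_of_isOpen hU le_rfl).comp hrot.continuousOn
      fun q hq => hsub (hmem q.1 q.2 hq.2)
  · intro s _ x hx
    have hd := ((hF.differentiableOn one_ne_zero).differentiableAt
      (hU.mem_nhds (hsub (hmem s x hx)))).hasFDerivAt
    exact hd.comp_hasDerivAt s (hasDerivAt_planeRotation i j s x)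

lemma ContDiffOn.rotDeriv {U : Set (E m)} (hU : IsOpen U) {f : E m → ℝ} {n k : WithTop ℕ∞}
    (hf : ContDiffOn ℝ n f U) (hk : k + 1 ≤ n) (i j : Fin m) :
    ContDiffOn ℝ k (rotDeriv i j f) U :=
  (hf.fderiv_of_isOpen hU hk).clm_apply (rotGen i j).contDiff.contDiffOn

lemma IsRotInvSphere.integral_rotDeriv_mul {ν : Measure (E m)} (hν : IsRotInvSphere ν)
    {U : Set (E m)} (hU : IsOpen U) (hsub : sphere 0 1 ⊆ U) {f g : E m → ℝ}
    (hf : ContDiffOn ℝ 1 f U) (hg : ContDiffOn ℝ 1 g U) (i j : Fin m) :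
    ∫ x, rotDeriv i j f x * g x ∂ν = -∫ x, f x * rotDeriv i j g x ∂ν := by
  have h := hν.integral_rotDeriv hU hsub (hf.mul hg) i j
  have hcf := ((hf.rotDeriv hU (k := 0) (by simp) i j).continuousOn).mono hsub
  have hcg := ((hg.rotDeriv hU (k := 0) (by simp) i j).continuousOn).mono hsub
  have hif : Integrable (fun x => _root_.rotDeriv i j f x * g x) ν :=
    hν.integrable (hcf.mul (hg.continuousOn.mono hsub))
  have hig : Integrable (fun x => f x * _root_.rotDeriv i j g x) ν :=
    hν.integrable ((hf.continuousOn.mono hsub).mul hcg)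
  have hprod : ∫ x, rotDeriv i j (fun y => f y * g y) x ∂ν
      = ∫ x, (rotDeriv i j f x * g x + f x * rotDeriv i j g x) ∂ν := by
    refine hν.integral_congr fun x hx => ?_
    have hdf := (hf.differentiableOn one_ne_zero).differentiableAt (hU.mem_nhds (hsub hx))
    have hdg := (hg.differentiableOn one_ne_zero).differentiableAt (hU.mem_nhds (hsub hx))
    simp only [_root_.rotDeriv]
    rw [fderiv_fun_mul hdf hdg]
    simp
    ring
  have h' : ∫ x, rotDeriv i j (fun y => f y * g y) x ∂ν = 0 := h
  rw [hprod, integral_add hif hig] at h'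
  linarith

lemma IsRotInvSphere.integral_sphLap_mul {ν : Measure (E m)} (hν : IsRotInvSphere ν)
    {U : Set (E m)} (hU : IsOpen U) (hsub : sphere 0 1 ⊆ U) {f g : E m → ℝ}
    (hf : ContDiffOn ℝ 2 f U) (hg : ContDiffOn ℝ 2 g U) :
    ∫ x, sphLap f x * g x ∂ν = ∫ x, f x * sphLap g x ∂ν := by
  have h12 : (1 : WithTop ℕ∞) + 1 ≤ 2 := by norm_num
  have hcont : ∀ {f : E m → ℝ}, ContDiffOn ℝ 2 f U → ∀ i j,
      ContinuousOn (rotDeriv i j (rotDeriv i j f)) (sphere 0 1) := fun hf i j =>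
    (((hf.rotDeriv hU h12 i j).rotDeriv hU (k := 0) (by simp) i j).continuousOn).mono hsub
  have hi : ∀ i j, Integrable (fun x => rotDeriv i j (rotDeriv i j f) x * g x) ν := fun i j =>
    hν.integrable ((hcont hf i j).mul (hg.continuousOn.mono hsub))
  have hi' : ∀ i j, Integrable (fun x => f x * rotDeriv i j (rotDeriv i j g) x) ν := fun i j =>
    hν.integrable ((hf.continuousOn.mono hsub).mul (hcont hg i j))
  simp only [sphLap, Finset.sum_mul, Finset.mul_sum]
  rw [integral_finsetSum _ fun i _ => integrable_finsetSum _ fun j _ => hi i j,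
    integral_finsetSum _ fun i _ => integrable_finsetSum _ fun j _ => hi' i j]
  refine Finset.sum_congr rfl fun i _ => ?_
  rw [integral_finsetSum _ fun j _ => hi i j, integral_finsetSum _ fun j _ => hi' i j]
  refine Finset.sum_congr rfl fun j _ => ?_
  rw [hν.integral_rotDeriv_mul hU hsub (hf.rotDeriv hU h12 i j) (hg.of_le one_le_two),
    hν.integral_rotDeriv_mul hU hsub (hf.of_le one_le_two) (hg.rotDeriv hU h12 i j), neg_neg]

end Rotation
section SphericalLaplacian

variable {m : ℕ}

lemma EuclideanSpace.sum_smul_single (x : E m) :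
    x = ∑ i, x i • EuclideanSpace.single i (1 : ℝ) := by
  ext j
  simp [Pi.single_apply]

lemma rotDeriv_rotDeriv {f : E m → ℝ} {x : E m} (hf : ContDiffAt ℝ 2 f x) (i j : Fin m) :
    rotDeriv i j (rotDeriv i j f) x = fderiv ℝ (fderiv ℝ f) x (rotGen i j x) (rotGen i j x)
      + fderiv ℝ f x (rotGen i j (rotGen i j x)) := by
  have h1 : HasFDerivAt (fderiv ℝ f) (fderiv ℝ (fderiv ℝ f) x) x :=
    ((hf.fderiv_right (m := 1) (by norm_num)).differentiableAt one_ne_zero).hasFDerivAt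
  have h2 := h1.clm_apply (rotGen i j).hasFDerivAt
  have h3 : fderiv ℝ (rotDeriv i j f) x = _ := h2.fderiv
  rw [rotDeriv, h3]
  simp
  ring

lemma sphLap_eq {f : E m → ℝ} {x : E m} (hf : ContDiffAt ℝ 2 f x) :
    sphLap f x = 2 * (‖x‖ ^ 2 * elap f x - fderiv ℝ (fderiv ℝ f) x x x
      - ((m : ℝ) - 1) * fderiv ℝ f x x) := by
  set B := fderiv ℝ (fderiv ℝ f) x
  set L := fderiv ℝ f x
  set e : Fin m → E m := fun i => EuclideanSpace.single i (1 : ℝ) with he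
  have hlap : elap f x = ∑ i, B (e i) (e i) := by
    simp [elap, iteratedFDeriv_two_apply, B, he]
  have hB : B x x = ∑ i, ∑ j, x i * x j * B (e i) (e j) := by
    conv_lhs => rw [EuclideanSpace.sum_smul_single x]
    simp [map_sum, Finset.mul_sum, he, mul_assoc]
    rw [Finset.sum_comm]
    exact Finset.sum_congr rfl fun i _ => Finset.sum_congr rfl fun j _ => by ring
  have hL : L x = ∑ i, x i * L (e i) := by
    conv_lhs => rw [EuclideanSpace.sum_smul_single x]
    simp [map_sum, he]
  have hterm : ∀ i j, rotDeriv i j (rotDeriv i j f) x =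
      x i ^ 2 * B (e j) (e j) + x j ^ 2 * B (e i) (e i)
      - x i * x j * B (e i) (e j) - x j * x i * B (e j) (e i)
      + ((if i = j then x i * L (e j) else 0) + (if i = j then x j * L (e i) else 0)
      - x j * L (e j) - x i * L (e i)) := by
    intro i j
    rw [rotDeriv_rotDeriv hf]
    by_cases h : i = j
    · subst h
      simp [rotGen_apply]
      ring
    · simp [rotGen_apply, h, Ne.symm h, he, B, L]
      ring
  have hBswap : ∑ i, ∑ j, x j * x i * B (e j) (e i) = B x x := by rw [Finset.sum_comm, hB]
  have hsq : ∑ i, ∑ j, x i ^ 2 * B (e j) (e j) = ‖x‖ ^ 2 * elap f x := by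
    rw [hlap, EuclideanSpace.norm_sq_eq, Finset.sum_mul_sum]
    simp
  have hsq' : ∑ i, ∑ j, x j ^ 2 * B (e i) (e i) = ‖x‖ ^ 2 * elap f x := by
    rw [Finset.sum_comm, hsq]
  simp only [sphLap, hterm, Finset.sum_add_distrib, Finset.sum_sub_distrib, hsq, hsq', hBswap, ← hB]
  simp only [Finset.sum_ite_eq, Finset.mem_univ, if_true, Finset.sum_const, Finset.card_univ,
    Fintype.card_fin, nsmul_eq_mul, ← Finset.mul_sum, ← hL]
  ring

lemma rotDeriv_comp_smul (i j : Fin m) (r : ℝ) (f : E m → ℝ) (x : E m) :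
    rotDeriv i j (fun y => f (r • y)) x = rotDeriv i j f (r • x) := by
  simp [rotDeriv, fderiv_comp_smul]

lemma sphLap_comp_smul (r : ℝ) (f : E m → ℝ) (x : E m) :
    sphLap (fun y => f (r • y)) x = sphLap f (r • x) := by
  have h : ∀ i j, rotDeriv i j (fun y => f (r • y)) = fun y => rotDeriv i j f (r • y) :=
    fun i j => funext fun y => rotDeriv_comp_smul i j r f y
  simp only [sphLap, h, rotDeriv_comp_smul]

/-- The function on `E m` defined by a polynomial. -/
def polyFun (p : MvPolynomial (Fin m) ℝ) (x : E m) : ℝ := MvPolynomial.eval (fun i => x i) p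

lemma contDiff_polyFun (p : MvPolynomial (Fin m) ℝ) {n : WithTop ℕ∞} :
    ContDiff ℝ n (polyFun p) := by
  unfold polyFun
  induction p using MvPolynomial.induction_on with
  | C a => simpa using contDiff_const
  | add p q hp hq => simpa using hp.add hq
  | mul_X p i hp =>
    simp only [map_mul, MvPolynomial.eval_X]
    exact hp.mul (EuclideanSpace.proj i : E m →L[ℝ] ℝ).contDiff

lemma rotDeriv_polyFun (i j : Fin m) (p : MvPolynomial (Fin m) ℝ) :
    rotDeriv i j (polyFun p) = polyFun (polyRot i j p) := by
  funext x
  have hdiff : ∀ p : MvPolynomial (Fin m) ℝ, DifferentiableAt ℝ (polyFun p) x := fun p =>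
    (contDiff_polyFun p (n := 1)).differentiable one_ne_zero x
  induction p using MvPolynomial.induction_on with
  | C a =>
    have : polyFun (MvPolynomial.C a) = fun _ : E m => a := by
      funext y
      simp [polyFun]
    rw [rotDeriv, this]
    simp [polyFun]
  | add p q hp hq =>
    have : polyFun (p + q) = fun y => polyFun p y + polyFun q y := by
      funext y
      simp [polyFun]
    rw [rotDeriv, this, fderiv_fun_add (hdiff p) (hdiff q)]
    simp only [rotDeriv] at hp hq
    simp [hp, hq, polyFun]
  | mul_X p k hp =>
    have hk : HasFDerivAt (polyFun (MvPolynomial.X k))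
        (EuclideanSpace.proj k : E m →L[ℝ] ℝ) x := by
      have : polyFun (MvPolynomial.X k) = (EuclideanSpace.proj k : E m →L[ℝ] ℝ) := by
        funext y
        simp [polyFun]
      rw [this]
      exact ContinuousLinearMap.hasFDerivAt _
    have : polyFun (p * MvPolynomial.X k)
        = fun y => polyFun p y * polyFun (MvPolynomial.X k) y := by
      funext y
      simp [polyFun]
    rw [rotDeriv, this, fderiv_fun_mul (hdiff p) hk.differentiableAt, hk.fderiv]
    simp only [rotDeriv] at hp
    have hX : polyFun (polyRot i j (MvPolynomial.X k)) x = rotGen i j x k := by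
      simp [polyFun, MvPolynomial.polyRot_apply, MvPolynomial.pderiv_X, rotGen_apply,
        Pi.single_apply, apply_ite (MvPolynomial.eval _)]
    simp only [Derivation.leibniz, smul_eq_mul, polyFun, map_add, map_mul] at hX hp ⊢
    simp [hp, hX]

lemma sphLap_polyFun (p : MvPolynomial (Fin m) ℝ) :
    sphLap (polyFun p) = polyFun (polySphLap p) := by
  funext x
  simp [sphLap, rotDeriv_polyFun, MvPolynomial.polySphLap_apply, polyFun]

end SphericalLaplacian
section RadialCoefficient

variable {m : ℕ} {ν : Measure (E m)}

lemma integral_lincomb₄ {f₁ f₂ f₃ f₄ : E m → ℝ} (h₁ : Integrable f₁ ν) (h₂ : Integrable f₂ ν)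
    (h₃ : Integrable f₃ ν) (h₄ : Integrable f₄ ν) {a b c d : ℝ} :
    ∫ x, (a * f₁ x + b * f₂ x + c * f₃ x + d * f₄ x) ∂ν
      = a * ∫ x, f₁ x ∂ν + b * ∫ x, f₂ x ∂ν + c * ∫ x, f₃ x ∂ν + d * ∫ x, f₄ x ∂ν := by
  have h₁' := h₁.const_mul a
  have h₂' := h₂.const_mul b
  have h₃' := h₃.const_mul c
  have h₁₂ : Integrable (fun x => a * f₁ x + b * f₂ x) ν := h₁'.add h₂'
  have h₁₂₃ : Integrable (fun x => a * f₁ x + b * f₂ x + c * f₃ x) ν := h₁₂.add h₃'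
  rw [integral_add h₁₂₃ (h₄.const_mul d), integral_add h₁₂ h₃', integral_add h₁' h₂']
  simp only [integral_const_mul]

lemma IsRotInvSphere.continuousOn_integral (hν : IsRotInvSphere ν) {K : Set ℝ} (hK : IsCompact K)
    {G : ℝ → E m → ℝ} (hG : ContinuousOn (fun q : ℝ × E m => G q.1 q.2) (K ×ˢ sphere 0 1)) :
    ContinuousOn (fun s => ∫ x, G s x ∂ν) K := by
  obtain ⟨C, hC⟩ := (hK.prod (isCompact_sphere (0 : E m) 1)).exists_bound_of_continuousOn hG
  have := hν.isProb
  refine continuousOn_of_dominated (bound := fun _ => C) (fun s hs => ?_) (fun s hs => ?_)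
    (integrable_const C) ?_
  · exact (hν.integrable (hG.comp (f := fun x : E m => (s, x)) (by fun_prop)
      fun x hx => ⟨hs, hx⟩)).aestronglyMeasurable
  · filter_upwards [hν.ae_mem] with x hx using hC (s, x) ⟨hs, hx⟩
  · filter_upwards [hν.ae_mem] with x hx
    exact hG.comp (f := fun s : ℝ => (s, x)) (by fun_prop) fun s hs => ⟨hs, hx⟩

lemma IsRotInvSphere.integral_smul_mul_eigen_decay (hν : IsRotInvSphere ν) (hm : 1 ≤ m)
    {γ ε R0 : ℝ} (hγ : 0 < γ) (hε : 0 < ε) (hR0 : 0 < R0) {v1 : E m → ℝ}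
    (hv1 : ContDiffOn ℝ 2 v1 (ball (0 : E m) R0))
    (hv1c : ContinuousOn v1 (closure (ball (0 : E m) R0)))
    (hpde : ∀ y ∈ ball (0 : E m) R0,
      (ε + ‖y‖^2) * elap v1 y + 2 * ⟪y, gradient v1 y⟫ - (2/γ) * v1 y = 0)
    {p : MvPolynomial (Fin m) ℝ} {lam : ℝ} (hlam : (m : ℝ) - 1 ≤ lam)
    (hp : polySphLap p = -(2 * lam) • p) (hmean : ∫ x, polyFun p x ∂ν = 0)
    {ρ R : ℝ} (hρ : 0 < ρ) (hρR : ρ < R) (hR : R ≤ R0) :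
    |∫ x, v1 (ρ • x) * polyFun p x ∂ν| ≤
      (ρ/R) ^ (min ((-(m:ℝ) + Real.sqrt ((m:ℝ)^2 + 4*((m:ℝ) - 1 + 2/γ)))/2) 1) *
        |∫ x, v1 (R • x) * polyFun p x ∂ν| := by
  rw [closure_ball _ hR0.ne'] at hv1c
  have hpc : Continuous (polyFun p) := (contDiff_polyFun p (n := 0)).continuous
  have hball : ∀ r ∈ Ioo 0 R, ∀ x ∈ sphere (0 : E m) 1, r • x ∈ ball (0 : E m) R0 := by
    intro r hr x hx
    rw [mem_sphere_zero_iff_norm] at hx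
    rw [mem_ball_zero_iff, norm_smul, hx, Real.norm_of_nonneg hr.1.le]
    linarith [hr.2]
  have hclosed : ∀ r ∈ Icc 0 R, ∀ x ∈ sphere (0 : E m) 1, r • x ∈ closedBall (0 : E m) R0 := by
    intro r hr x hx
    rw [mem_sphere_zero_iff_norm] at hx
    rw [mem_closedBall_zero_iff, norm_smul, hx, Real.norm_of_nonneg hr.1]
    linarith [hr.2]
  have hD1 : ContDiffOn ℝ 1 (fderiv ℝ v1) (ball 0 R0) :=
    hv1.fderiv_of_isOpen isOpen_ball (by norm_num)
  have hD2 : ContinuousOn (fderiv ℝ (fderiv ℝ v1)) (ball 0 R0) :=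
    hD1.continuousOn_fderiv_of_isOpen isOpen_ball le_rfl
  have hmaps : MapsTo (fun q : ℝ × E m => q.1 • q.2) (Ioo 0 R ×ˢ sphere 0 1) (ball 0 R0) :=
    fun q hq => hball q.1 hq.1 q.2 hq.2
  have hsm : ContinuousOn (fun q : ℝ × E m => q.1 • q.2) (Ioo 0 R ×ˢ sphere 0 1) :=
    continuous_smul.continuousOn
  have c1 : ContinuousOn (fun q : ℝ × E m => fderiv ℝ v1 (q.1 • q.2) q.2 * polyFun p q.2)
      (Ioo 0 R ×ˢ sphere 0 1) :=
    ((hD1.continuousOn.comp hsm hmaps).clm_apply continuousOn_snd).mul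
      (hpc.comp continuous_snd).continuousOn
  have c2 : ContinuousOn
      (fun q : ℝ × E m => fderiv ℝ (fderiv ℝ v1) (q.1 • q.2) q.2 q.2 * polyFun p q.2)
      (Ioo 0 R ×ˢ sphere 0 1) :=
    (((hD2.comp hsm hmaps).clm_apply continuousOn_snd).clm_apply continuousOn_snd).mul
      (hpc.comp continuous_snd).continuousOn
  have slice : ∀ {G : ℝ × E m → ℝ}, ContinuousOn G (Ioo 0 R ×ˢ sphere 0 1) → ∀ r ∈ Ioo 0 R,
      ContinuousOn (fun x => G (r, x)) (sphere 0 1) := fun hG r hr =>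
    hG.comp (f := fun x : E m => (r, x)) (by fun_prop) fun x hx => ⟨hr, hx⟩
  have c0 : ContinuousOn (fun q : ℝ × E m => v1 (q.1 • q.2) * polyFun p q.2)
      (Ioo 0 R ×ˢ sphere 0 1) :=
    (hv1.continuousOn.comp hsm hmaps).mul (hpc.comp continuous_snd).continuousOn
  have hsmul : ∀ (r : ℝ) (x : E m), HasDerivAt (fun s : ℝ => s • x) x r := fun r x => by
    simpa using (hasDerivAt_id r).smul_const x
  have d1 : ∀ r ∈ Ioo 0 R, HasDerivAt (fun r => ∫ x, v1 (r • x) * polyFun p x ∂ν)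
      (∫ x, fderiv ℝ v1 (r • x) x * polyFun p x ∂ν) r := fun r hr =>
    hν.hasDerivAt_integral isOpen_Ioo hr (G := fun r x => v1 (r • x) * polyFun p x)
      (G' := fun r x => fderiv ℝ v1 (r • x) x * polyFun p x) (slice c0) c1 fun s hs x hx =>
      ((((hv1.differentiableOn two_ne_zero).differentiableAt
        (isOpen_ball.mem_nhds (hball s hs x hx))).hasFDerivAt).comp_hasDerivAt s
          (hsmul s x)).mul_const _
  have d2 : ∀ r ∈ Ioo 0 R, HasDerivAt (fun r => ∫ x, fderiv ℝ v1 (r • x) x * polyFun p x ∂ν)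
      (∫ x, fderiv ℝ (fderiv ℝ v1) (r • x) x x * polyFun p x ∂ν) r := fun r hr =>
    hν.hasDerivAt_integral isOpen_Ioo hr (G := fun r x => fderiv ℝ v1 (r • x) x * polyFun p x)
      (G' := fun r x => fderiv ℝ (fderiv ℝ v1) (r • x) x x * polyFun p x) (slice c1) c2
      fun s hs x hx => by
      have h := (((hD1.differentiableOn one_ne_zero).differentiableAt
        (isOpen_ball.mem_nhds (hball s hs x hx))).hasFDerivAt).comp_hasDerivAt s (hsmul s x)
      have h' := h.clm_apply (hasDerivAt_const s x)
      simpa using h'.mul_const (polyFun p x)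
  have hcont : ContinuousOn (fun r => ∫ x, v1 (r • x) * polyFun p x ∂ν) (Icc 0 R) := by
    refine hν.continuousOn_integral isCompact_Icc ?_
    exact (hv1c.comp continuous_smul.continuousOn fun q hq => hclosed q.1 hq.1 q.2 hq.2).mul
      (hpc.comp continuous_snd).continuousOn
  refine radial_decay (V := fun r => ∫ x, v1 (r • x) * polyFun p x ∂ν) (by exact_mod_cast hm)
    hγ hε hlam rfl hcont ?_ d1 d2 ?_ ⟨hρ, hρR⟩
  · simp [integral_const_mul, hmean]
  · intro r hr
    have hr0 : 0 < r := hr.1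
    set U : Set (E m) := (fun x => r • x) ⁻¹' ball 0 R0 with hU
    have hUo : IsOpen U := isOpen_ball.preimage (by fun_prop)
    have hsub : sphere 0 1 ⊆ U := fun x hx => hball r hr x hx
    have hf : ContDiffOn ℝ 2 (fun x => v1 (r • x)) U :=
      hv1.comp (contDiff_const_smul r).contDiffOn fun x hx => hx
    have hLap := hν.integral_sphLap_mul hUo hsub hf (contDiff_polyFun p).contDiffOn
    rw [sphLap_polyFun, hp] at hLap
    have hLap' : ∫ x, sphLap v1 (r • x) * polyFun p x ∂ν
        = -(2 * lam) * ∫ x, v1 (r • x) * polyFun p x ∂ν := by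
      rw [← integral_const_mul]
      simp only [sphLap_comp_smul] at hLap
      rw [hLap]
      refine hν.integral_congr fun x _ => ?_
      simp [polyFun, MvPolynomial.smul_eval]
      ring
    have hpt : ∀ x ∈ sphere (0 : E m) 1, sphLap v1 (r • x)
        = 2 * (r ^ 2 * elap v1 (r • x) - r ^ 2 * fderiv ℝ (fderiv ℝ v1) (r • x) x x
          - ((m : ℝ) - 1) * (r * fderiv ℝ v1 (r • x) x)) := by
      intro x hx
      rw [sphLap_eq (hv1.contDiffAt (isOpen_ball.mem_nhds (hball r hr x hx))), norm_smul,
        mem_sphere_zero_iff_norm.1 hx]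
      simp
      ring
    have hpde' : ∀ x ∈ sphere (0 : E m) 1,
        (ε + r ^ 2) * elap v1 (r • x) + 2 * (r * fderiv ℝ v1 (r • x) x)
          - (2/γ) * v1 (r • x) = 0 := by
      intro x hx
      have h := hpde _ (hball r hr x hx)
      rw [norm_smul, mem_sphere_zero_iff_norm.1 hx, real_inner_comm, gradient,
        InnerProductSpace.toDual_symm_apply] at h
      simpa using h
    have i0 : Integrable (fun x => v1 (r • x) * polyFun p x) ν := hν.integrable (slice c0 r hr)
    have i1 : Integrable (fun x => fderiv ℝ v1 (r • x) x * polyFun p x) ν :=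
      hν.integrable (slice c1 r hr)
    have i2 : Integrable (fun x => fderiv ℝ (fderiv ℝ v1) (r • x) x x * polyFun p x) ν :=
      hν.integrable (slice c2 r hr)
    have cL : ContinuousOn (fun x => sphLap v1 (r • x) * polyFun p x) (sphere 0 1) := by
      simp only [← sphLap_comp_smul]
      refine ContinuousOn.mul ?_ hpc.continuousOn
      refine continuousOn_finsetSum _ fun i _ => continuousOn_finsetSum _ fun j _ => ?_
      exact (((hf.rotDeriv hUo (k := 1) (by norm_num) i j).rotDeriv hUo (k := 0)
        (by simp) i j).continuousOn).mono hsub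
    have iL := hν.integrable cL
    have hzero : ∫ x, ((ε + r ^ 2) * r ^ 2 * (fderiv ℝ (fderiv ℝ v1) (r • x) x x * polyFun p x)
        + ((ε + r ^ 2) * (m - 1) * r + 2 * r ^ 2 * r) * (fderiv ℝ v1 (r • x) x * polyFun p x)
        + (ε + r ^ 2) / 2 * (sphLap v1 (r • x) * polyFun p x)
        + -(2 / γ * r ^ 2) * (v1 (r • x) * polyFun p x)) ∂ν = 0 := by
      rw [← integral_zero (E m) ℝ (μ := ν)]
      refine hν.integral_congr fun x hx => ?_
      rw [hpt x hx]
      linear_combination r ^ 2 * polyFun p x * hpde' x hx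
    rw [integral_lincomb₄ i2 i1 iL i0, hLap'] at hzero
    linear_combination hzero

end RadialCoefficient
section Decay

variable {m : ℕ} {ν : Measure (E m)}

lemma exists_polyFun_near {F : E m → ℝ} (hF : ContinuousOn F (sphere 0 1)) {η : ℝ} (hη : 0 < η) :
    ∃ p : MvPolynomial (Fin m) ℝ, ∀ x ∈ sphere (0 : E m) 1, |F x - polyFun p x| < η := by
  let coord : Fin m → C(sphere (0 : E m) 1, ℝ) := fun i => ⟨fun x => x.1 i, by fun_prop⟩
  have hev : ∀ (p : MvPolynomial (Fin m) ℝ) (x : sphere (0 : E m) 1),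
      MvPolynomial.aeval coord p x = polyFun p x.1 := by
    intro p x
    induction p using MvPolynomial.induction_on with
    | C a => simp [polyFun]
    | add p q hp hq => simp_all [polyFun]
    | mul_X p i hp => simp_all [polyFun, coord]
  have hsep : (MvPolynomial.aeval (R := ℝ) coord).range.SeparatesPoints := fun x y hxy => by
    obtain ⟨i, hi⟩ : ∃ i, x.1 i ≠ y.1 i := by
      by_contra! h
      exact hxy (Subtype.ext (PiLp.ext h))
    exact ⟨coord i, ⟨coord i, ⟨MvPolynomial.X i, by simp⟩, rfl⟩, hi⟩
  obtain ⟨⟨_, p, rfl⟩, hg⟩ :=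
    ContinuousMap.exists_mem_subalgebra_near_continuous_of_separatesPoints _ hsep (fun x => F x.1)
      (continuousOn_iff_continuous_domRestrict.1 hF) η hη
  refine ⟨p, fun x hx => ?_⟩
  have := hg ⟨x, hx⟩
  rw [Real.norm_eq_abs, abs_sub_comm] at this
  rw [← hev p ⟨x, hx⟩]
  exact this

namespace IsRotInvSphere

/-- Integration of polynomials against a function on the sphere. -/
def pairing (hν : IsRotInvSphere ν) {F : E m → ℝ} (hF : ContinuousOn F (sphere 0 1)) :
    MvPolynomial (Fin m) ℝ →ₗ[ℝ] ℝ where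
  toFun p := ∫ x, F x * polyFun p x ∂ν
  map_add' p q := by
    rw [← integral_add (hν.integrable (f := fun x => F x * polyFun p x)
        (hF.mul (contDiff_polyFun p (n := 0)).continuous.continuousOn))
      (hν.integrable (f := fun x => F x * polyFun q x)
        (hF.mul (contDiff_polyFun q (n := 0)).continuous.continuousOn))]
    exact hν.integral_congr fun x _ => by simp [polyFun, mul_add]
  map_smul' c p := by
    rw [RingHom.id_apply, smul_eq_mul, ← integral_const_mul]
    exact hν.integral_congr fun x _ => by simp [polyFun, MvPolynomial.smul_eval]; ring

lemma pairing_apply (hν : IsRotInvSphere ν) {F : E m → ℝ} (hF : ContinuousOn F (sphere 0 1))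
    (p : MvPolynomial (Fin m) ℝ) : hν.pairing hF p = ∫ x, F x * polyFun p x ∂ν := rfl

lemma integrable_mul (hν : IsRotInvSphere ν) {F G : E m → ℝ} (hF : ContinuousOn F (sphere 0 1))
    (hG : ContinuousOn G (sphere 0 1)) : Integrable (fun x => F x * G x) ν :=
  hν.integrable (hF.mul hG)

lemma integrable_sq (hν : IsRotInvSphere ν) {F : E m → ℝ} (hF : ContinuousOn F (sphere 0 1)) :
    Integrable (fun x => F x ^ 2) ν :=
  hν.integrable (hF.pow 2)

lemma integral_sub_const_mul_polyFun (hν : IsRotInvSphere ν) {F : E m → ℝ}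
    (hF : ContinuousOn F (sphere 0 1)) (c : ℝ) {p : MvPolynomial (Fin m) ℝ}
    (hp : ∫ x, polyFun p x ∂ν = 0) :
    ∫ x, (F x - c) * polyFun p x ∂ν = ∫ x, F x * polyFun p x ∂ν := by
  have hpc : ContinuousOn (polyFun p) (sphere 0 1) :=
    (contDiff_polyFun p (n := 0)).continuous.continuousOn
  simp only [sub_mul]
  rw [integral_sub (hν.integrable_mul hF hpc) ((hν.integrable hpc).const_mul c),
    integral_const_mul, hp, mul_zero, sub_zero]

lemma integral_polyFun_mul_eq_zero (hν : IsRotInvSphere ν) {p q : MvPolynomial (Fin m) ℝ}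
    {a b : ℝ} (hp : polySphLap p = a • p) (hq : polySphLap q = b • q) (hab : a ≠ b) :
    ∫ x, polyFun p x * polyFun q x ∂ν = 0 := by
  have h := hν.integral_sphLap_mul isOpen_univ (subset_univ _)
    (contDiff_polyFun p).contDiffOn (contDiff_polyFun q).contDiffOn
  rw [sphLap_polyFun, sphLap_polyFun, hp, hq] at h
  have e1 : ∫ x, polyFun (a • p) x * polyFun q x ∂ν = a * ∫ x, polyFun p x * polyFun q x ∂ν := by
    rw [← integral_const_mul]
    exact hν.integral_congr fun x _ => by simp [polyFun, MvPolynomial.smul_eval]; ring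
  have e2 : ∫ x, polyFun p x * polyFun (b • q) x ∂ν = b * ∫ x, polyFun p x * polyFun q x ∂ν := by
    rw [← integral_const_mul]
    exact hν.integral_congr fun x _ => by simp [polyFun, MvPolynomial.smul_eval]; ring
  rw [e1, e2] at h
  exact (mul_eq_zero.1 (show (a - b) * ∫ x, polyFun p x * polyFun q x ∂ν = 0 by
    linarith)).resolve_left (sub_ne_zero.2 hab)

lemma integral_polyFun_eq_zero (hν : IsRotInvSphere ν) {p : MvPolynomial (Fin m) ℝ}
    {a : ℝ} (hp : polySphLap p = a • p) (ha : a ≠ 0) : ∫ x, polyFun p x ∂ν = 0 := by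
  have h1 : polySphLap (1 : MvPolynomial (Fin m) ℝ) = (0 : ℝ) • 1 := by
    simp [MvPolynomial.polySphLap_apply]
  simpa [polyFun] using hν.integral_polyFun_mul_eq_zero hp h1 ha

lemma integral_sq_sum_of_orthogonal (hν : IsRotInvSphere ν) {ι : Type*} [DecidableEq ι]
    (s : Finset ι)
    (g : ι → MvPolynomial (Fin m) ℝ)
    (horth : ∀ k l, k ≠ l → ∫ x, polyFun (g k) x * polyFun (g l) x ∂ν = 0) (c : ι → ℝ) :
    ∫ x, polyFun (∑ k ∈ s, c k • g k) x ^ 2 ∂ν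
      = ∑ k ∈ s, c k ^ 2 * ∫ x, polyFun (g k) x ^ 2 ∂ν := by
  have hone : ContinuousOn (fun _ : E m => (1 : ℝ)) (sphere 0 1) := continuousOn_const
  have hpair : ∀ p q : MvPolynomial (Fin m) ℝ,
      ∫ x, polyFun p x * polyFun q x ∂ν = hν.pairing hone (p * q) := fun p q => by
    simp [pairing_apply, polyFun]
  simp only [sq, hpair] at horth ⊢
  rw [Finset.sum_mul_sum, map_sum]
  refine Finset.sum_congr rfl fun k hk => ?_
  rw [map_sum, Finset.sum_eq_single k]
  · rw [smul_mul_smul_comm, map_smul, smul_eq_mul]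
  · intro l _ hl
    rw [smul_mul_smul_comm, map_smul, horth k l hl.symm, smul_zero]
  · exact fun h => absurd hk h

lemma abs_integral_mul_polyFun_le (hν : IsRotInvSphere ν) (hm : 1 ≤ m) {F G : E m → ℝ} {q : ℝ}
    (hq : 0 ≤ q) (hF : ContinuousOn F (sphere 0 1)) (hG : ContinuousOn G (sphere 0 1))
    (hFG : ∀ (p : MvPolynomial (Fin m) ℝ) (lam : ℝ), (m : ℝ) - 1 ≤ lam →
      polySphLap p = -(2 * lam) • p → ∫ x, polyFun p x ∂ν = 0 →
      |∫ x, F x * polyFun p x ∂ν| ≤ q * |∫ x, G x * polyFun p x ∂ν|)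
    (c : ℝ) {p : MvPolynomial (Fin m) ℝ} (hp : ∫ x, polyFun p x ∂ν = 0) :
    |∫ x, F x * polyFun p x ∂ν|
      ≤ q * (Real.sqrt (∫ x, (G x - c) ^ 2 ∂ν) * Real.sqrt (∫ x, polyFun p x ^ 2 ∂ν)) := by
  have hprob := hν.isProb
  have hcont : ∀ p : MvPolynomial (Fin m) ℝ, ContinuousOn (polyFun p) (sphere 0 1) := fun p =>
    (contDiff_polyFun p (n := 0)).continuous.continuousOn
  have hGc : ∀ p : MvPolynomial (Fin m) ℝ, ∫ x, polyFun p x ∂ν = 0 →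
      |∫ x, G x * polyFun p x ∂ν|
        ≤ Real.sqrt (∫ x, (G x - c) ^ 2 ∂ν) * Real.sqrt (∫ x, polyFun p x ^ 2 ∂ν) := by
    intro p hp
    rw [← hν.integral_sub_const_mul_polyFun hG c hp]
    exact hν.abs_integral_mul_le (hG.sub continuousOn_const) (hcont p)
  rcases hm.eq_or_lt with rfl | hm2
  · have hp0 : polySphLap p = -(2 * (0 : ℝ)) • p := by
      simp [MvPolynomial.polySphLap_apply, MvPolynomial.polyRot_apply]
    exact (hFG p 0 (by simp) hp0 hp).trans (mul_le_mul_of_nonneg_left (hGc p hp) hq)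
  obtain ⟨N, h, hh, ⟨b, hb⟩, hsum⟩ := MvPolynomial.exists_eigen_decomp hm p
  have hm2' : (2 : ℝ) ≤ m := by exact_mod_cast hm2
  set μ : ℕ → ℝ := fun k => (k : ℝ) * (k + m - 2) with hμ
  set g : ℕ → MvPolynomial (Fin m) ℝ := fun k => h (k + 1) with hg
  have hμ1 : ∀ k, (m : ℝ) - 1 ≤ μ (k + 1) := by
    intro k
    have : (0 : ℝ) ≤ k := Nat.cast_nonneg k
    simp only [hμ]
    push_cast
    nlinarith
  have hg0 : ∀ k, ∫ x, polyFun (g k) x ∂ν = 0 := fun k =>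
    hν.integral_polyFun_eq_zero (hh (k + 1)) (by have := hμ1 k; simp only [hμ] at this; linarith)
  have horth : ∀ k l, k ≠ l → ∫ x, polyFun (g k) x * polyFun (g l) x ∂ν = 0 := by
    intro k l hkl
    refine hν.integral_polyFun_mul_eq_zero (hh (k + 1)) (hh (l + 1)) fun heq => ?_
    have hk : (0 : ℝ) ≤ k := Nat.cast_nonneg k
    have hl : (0 : ℝ) ≤ l := Nat.cast_nonneg l
    push_cast at heq
    have h0 : ((k : ℝ) - l) * (k + l + m) = 0 := by linarith
    rcases mul_eq_zero.1 h0 with h1 | h1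
    · exact hkl (by exact_mod_cast sub_eq_zero.1 h1)
    · linarith
  have hone : ContinuousOn (fun _ : E m => (1 : ℝ)) (sphere 0 1) := continuousOn_const
  have hmean : ∀ p : MvPolynomial (Fin m) ℝ, hν.pairing hone p = ∫ x, polyFun p x ∂ν := fun p => by
    simp [pairing_apply]
  rw [Finset.sum_range_succ'] at hsum
  have hb0 : b = 0 := by
    have h1 := congrArg (hν.pairing hone) hsum
    rw [map_add, map_sum] at h1
    simp only [hmean] at h1
    rw [hp, Finset.sum_eq_zero fun k _ => hg0 k, zero_add] at h1
    have h2 : ∫ x, polyFun (h 0) x ∂ν = ∫ _, b ∂ν :=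
      hν.integral_congr fun x hx => hb x (mem_sphere_zero_iff_norm.1 hx)
    rw [h2] at h1
    simpa using h1.symm
  have hpt : ∀ x ∈ sphere (0 : E m) 1, polyFun p x
      = polyFun (∑ k ∈ Finset.range N, (1 : ℝ) • g k) x := by
    intro x hx
    have h1 : polyFun (h 0) x = 0 := (hb x (mem_sphere_zero_iff_norm.1 hx)).trans hb0
    simp only [polyFun, one_smul] at h1 ⊢
    rw [hsum, map_add, h1, add_zero]
  set σ : ℕ → ℝ := fun k => if 0 ≤ ∫ x, G x * polyFun (g k) x ∂ν then 1 else -1 with hσ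
  have hσ1 : ∀ k, σ k ^ 2 = 1 := fun k => by simp only [hσ]; split_ifs <;> norm_num
  have hσ2 : ∀ k, σ k * ∫ x, G x * polyFun (g k) x ∂ν = |∫ x, G x * polyFun (g k) x ∂ν| := by
    intro k
    simp only [hσ]
    split_ifs with h0
    · rw [one_mul, abs_of_nonneg h0]
    · rw [abs_of_neg (not_le.1 h0)]
      ring
  set Q := ∑ k ∈ Finset.range N, σ k • g k with hQ
  have hQ0 : ∫ x, polyFun Q x ∂ν = 0 := by
    rw [← hmean, hQ, map_sum]
    exact Finset.sum_eq_zero fun k _ => by rw [map_smul, hmean, hg0, smul_zero]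
  have hQG : ∫ x, G x * polyFun Q x ∂ν
      = ∑ k ∈ Finset.range N, |∫ x, G x * polyFun (g k) x ∂ν| := by
    rw [← hν.pairing_apply hG, hQ, map_sum]
    exact Finset.sum_congr rfl fun k _ => by
      rw [map_smul, hν.pairing_apply hG, smul_eq_mul, hσ2]
  have hnorm : ∫ x, polyFun Q x ^ 2 ∂ν = ∫ x, polyFun p x ^ 2 ∂ν := by
    rw [hν.integral_congr fun x hx => congrArg (· ^ 2) (hpt x hx), hQ,
      hν.integral_sq_sum_of_orthogonal _ _ horth, hν.integral_sq_sum_of_orthogonal _ _ horth]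
    simp [hσ1]
  calc |∫ x, F x * polyFun p x ∂ν|
      = |∑ k ∈ Finset.range N, ∫ x, F x * polyFun (g k) x ∂ν| := by
        rw [hν.integral_congr fun x hx => congrArg (F x * ·) (hpt x hx)]
        rw [← hν.pairing_apply hF, map_sum]
        simp [hν.pairing_apply hF]
    _ ≤ ∑ k ∈ Finset.range N, |∫ x, F x * polyFun (g k) x ∂ν| := Finset.abs_sum_le_sum_abs _ _
    _ ≤ ∑ k ∈ Finset.range N, q * |∫ x, G x * polyFun (g k) x ∂ν| :=
        Finset.sum_le_sum fun k _ => hFG _ _ (hμ1 k) (hh (k + 1)) (hg0 k)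
    _ = q * ∫ x, G x * polyFun Q x ∂ν := by rw [← Finset.mul_sum, hQG]
    _ ≤ q * (Real.sqrt (∫ x, (G x - c) ^ 2 ∂ν) * Real.sqrt (∫ x, polyFun p x ^ 2 ∂ν)) := by
        rw [← hnorm]
        exact mul_le_mul_of_nonneg_left ((le_abs_self _).trans (hGc Q hQ0)) hq

lemma sqrt_variance_le (hν : IsRotInvSphere ν) {F : E m → ℝ} {K : ℝ}
    (hF : ContinuousOn F (sphere 0 1)) (hK : 0 ≤ K)
    (hFp : ∀ p : MvPolynomial (Fin m) ℝ, ∫ x, polyFun p x ∂ν = 0 →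
      |∫ x, F x * polyFun p x ∂ν| ≤ K * Real.sqrt (∫ x, polyFun p x ^ 2 ∂ν)) :
    Real.sqrt (∫ x, (F x - ∫ y, F y ∂ν) ^ 2 ∂ν) ≤ K := by
  have hprob := hν.isProb
  set c := ∫ y, F y ∂ν with hc
  set A := Real.sqrt (∫ x, (F x - c) ^ 2 ∂ν) with hA
  have hA0 : 0 ≤ A := Real.sqrt_nonneg _
  have hA2 : A ^ 2 = ∫ x, (F x - c) ^ 2 ∂ν := Real.sq_sqrt (integral_nonneg fun x => sq_nonneg _)
  have hcont : ∀ p : MvPolynomial (Fin m) ℝ, ContinuousOn (polyFun p) (sphere 0 1) := fun p =>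
    (contDiff_polyFun p (n := 0)).continuous.continuousOn
  have hFc : ContinuousOn (fun x => F x - c) (sphere 0 1) := hF.sub continuousOn_const
  have hFc0 : ∫ x, (F x - c) ∂ν = 0 := by
    rw [integral_sub (hν.integrable hF) (integrable_const c)]
    simp [hc]
  have key : ∀ η > 0, A ^ 2 ≤ K * (A + η) + A * η := by
    intro η hη
    obtain ⟨p₀, hp₀⟩ := exists_polyFun_near hFc (half_pos hη)
    set b := ∫ x, polyFun p₀ x ∂ν with hb
    have hbη : |b| ≤ η / 2 := by
      have h1 : b = ∫ x, (polyFun p₀ x - (F x - c)) ∂ν := by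
        rw [integral_sub (hν.integrable (hcont p₀)) (hν.integrable hFc), hFc0, sub_zero]
      rw [h1]
      have h2 := norm_integral_le_of_norm_le_const (μ := ν) (C := η / 2)
        (f := fun x => polyFun p₀ x - (F x - c)) (hν.ae_mem.mono fun x hx => by
          rw [Real.norm_eq_abs, abs_sub_comm]
          exact (hp₀ x hx).le)
      simpa using h2
    set p := p₀ - MvPolynomial.C b with hp
    have hpx : ∀ x, polyFun p x = polyFun p₀ x - b := fun x => by simp [polyFun, hp]
    have hp0 : ∫ x, polyFun p x ∂ν = 0 := by
      simp only [hpx]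
      rw [integral_sub (hν.integrable (hcont p₀)) (integrable_const b)]
      simp [hb]
    have hnear : ∀ x ∈ sphere (0 : E m) 1, |F x - c - polyFun p x| ≤ η := by
      intro x hx
      rw [hpx, show F x - c - (polyFun p₀ x - b) = (F x - c - polyFun p₀ x) + b by ring]
      refine (abs_add_le _ _).trans ?_
      linarith [hp₀ x hx]
    have hdc : ContinuousOn (fun x => F x - c - polyFun p x) (sphere 0 1) := hFc.sub (hcont p)
    have herr : Real.sqrt (∫ x, (F x - c - polyFun p x) ^ 2 ∂ν) ≤ η := by
      refine Real.sqrt_le_iff.2 ⟨hη.le, ?_⟩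
      have h1 : ∫ x, (F x - c - polyFun p x) ^ 2 ∂ν ≤ ∫ _, η ^ 2 ∂ν :=
        integral_mono_ae (hν.integrable (hdc.pow 2)) (integrable_const _)
          (hν.ae_mem.mono fun x hx => sq_le_sq.2 ((hnear x hx).trans (le_abs_self η)))
      simpa using h1
    have hcross := hν.abs_integral_mul_le hFc hdc
    have hsplit : A ^ 2 = (∫ x, F x * polyFun p x ∂ν)
        + ∫ x, (F x - c) * (F x - c - polyFun p x) ∂ν := by
      rw [← hν.integral_sub_const_mul_polyFun hF c hp0,
        ← integral_add (hν.integrable_mul hFc (hcont p)) (hν.integrable_mul hFc hdc), hA2]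
      exact hν.integral_congr fun x _ => by ring
    have hpnorm : Real.sqrt (∫ x, polyFun p x ^ 2 ∂ν) ≤ A + η := by
      refine Real.sqrt_le_iff.2 ⟨by positivity, ?_⟩
      have h1 : ∫ x, polyFun p x ^ 2 ∂ν = (∫ x, (F x - c) ^ 2 ∂ν)
          + ∫ x, (-2 * ((F x - c) * (F x - c - polyFun p x))
            + (F x - c - polyFun p x) ^ 2) ∂ν := by
        rw [← integral_add (hν.integrable_sq hFc) (g := fun x =>
            -2 * ((F x - c) * (F x - c - polyFun p x)) + (F x - c - polyFun p x) ^ 2)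
          (((hν.integrable_mul hFc hdc).const_mul (-2)).add (hν.integrable_sq hdc))]
        exact hν.integral_congr fun x _ => by ring
      rw [integral_add ((hν.integrable_mul hFc hdc).const_mul (-2)) (hν.integrable_sq hdc),
        integral_const_mul, ← hA2] at h1
      have h2 := Real.sq_sqrt (integral_nonneg (μ := ν)
        (fun x => sq_nonneg (F x - c - polyFun p x)))
      have h3 := (abs_le.1 hcross).1
      have h4 : A * Real.sqrt (∫ x, (F x - c - polyFun p x) ^ 2 ∂ν) ≤ A * η :=
        mul_le_mul_of_nonneg_left herr hA0
      have h5 := pow_le_pow_left₀ (Real.sqrt_nonneg _) herr 2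
      nlinarith
    have h6 := (le_abs_self _).trans (hFp p hp0)
    have h7 := (le_abs_self _).trans hcross
    have h8 := mul_le_mul_of_nonneg_left hpnorm hK
    have h9 := mul_le_mul_of_nonneg_left herr hA0
    linarith
  have hle : A ^ 2 ≤ K * A := by
    refine le_of_forall_pos_le_add fun δ hδ => ?_
    have h := key (δ / (K + A + 1)) (by positivity)
    have h1 : (K + A) * (δ / (K + A + 1)) ≤ δ := by
      rw [mul_div_assoc', div_le_iff₀ (by positivity)]
      nlinarith
    linarith
  rcases hA0.eq_or_lt with h0 | h0
  · rw [← h0]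
    exact hK
  · exact le_of_mul_le_mul_right (by linarith [sq A]) h0

end IsRotInvSphere

end Decay
section SphereMeasure

variable {m : ℕ}

/-- The surface measure of the unit sphere, normalized to be a probability measure. -/
def unitSphereMeasure (m : ℕ) : Measure (E m) :=
  (μH[(m : ℝ) - 1] (sphere (0 : E m) 1))⁻¹ • μH[(m : ℝ) - 1].restrict (sphere 0 1)

lemma smul_preimage_sphere {ρ : ℝ} (hρ : 0 < ρ) :
    (fun x : E m => ρ • x) ⁻¹' sphere 0 ρ = sphere 0 1 := by
  ext x
  simp [norm_smul, abs_of_pos hρ, hρ.ne']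

lemma hausdorffMeasure_preimage_smul (hm : 1 ≤ m) {ρ : ℝ} (hρ : 0 < ρ) (s : Set (E m)) :
    μH[(m : ℝ) - 1] s
      = (‖ρ‖₊ ^ ((m : ℝ) - 1)) • μH[(m : ℝ) - 1] ((fun x : E m => ρ • x) ⁻¹' s) := by
  have hd : (0 : ℝ) ≤ m - 1 := by
    have : (1 : ℝ) ≤ m := by exact_mod_cast hm
    linarith
  rw [← Measure.hausdorffMeasure_smul₀ hd hρ.ne']
  congr 1
  ext x
  rw [mem_smul_set_iff_inv_smul_mem₀ hρ.ne', mem_preimage, smul_inv_smul₀ hρ.ne']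

lemma normalized_sphere_eq_map (hm : 1 ≤ m) {ρ : ℝ} (hρ : 0 < ρ) :
    (μH[(m : ℝ) - 1] (sphere (0 : E m) ρ))⁻¹ • μH[(m : ℝ) - 1].restrict (sphere 0 ρ)
      = (unitSphereMeasure m).map (fun x => ρ • x) := by
  ext s hs
  have hmeas : Measurable fun x : E m => ρ • x := measurable_const_smul ρ
  have hr0 : ((‖ρ‖₊ ^ ((m : ℝ) - 1) : NNReal) : ℝ≥0∞) ≠ 0 := by
    simp [hρ.ne', NNReal.rpow_eq_zero_iff]
  rw [Measure.map_apply hmeas hs, unitSphereMeasure, Measure.smul_apply, Measure.smul_apply,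
    Measure.restrict_apply hs, Measure.restrict_apply (hmeas hs),
    hausdorffMeasure_preimage_smul hm hρ (sphere 0 ρ), hausdorffMeasure_preimage_smul hm hρ (s ∩ _),
    preimage_inter, smul_preimage_sphere hρ, ENNReal.smul_def, ENNReal.smul_def, smul_eq_mul,
    smul_eq_mul, smul_eq_mul, smul_eq_mul,
    ENNReal.mul_inv (Or.inl hr0) (Or.inl ENNReal.coe_ne_top), mul_mul_mul_comm,
    ENNReal.inv_mul_cancel hr0 ENNReal.coe_ne_top, one_mul]

lemma setAverage_sphere_eq (hm : 1 ≤ m) {ρ : ℝ} (hρ : 0 < ρ) (w : E m → ℝ) :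
    ⨍ x in sphere (0 : E m) ρ, w x ∂(μH[(m : ℝ) - 1])
      = ∫ x, w (ρ • x) ∂(unitSphereMeasure m) := by
  rw [setAverage_eq', normalized_sphere_eq_map hm hρ]
  exact (Homeomorph.smulOfNeZero ρ hρ.ne').measurableEmbedding.integral_map w

lemma sDev_eq (hm : 1 ≤ m) {ρ : ℝ} (hρ : 0 < ρ) (w : E m → ℝ) :
    sDev ρ w = Real.sqrt (∫ x, (w (ρ • x) - ∫ y, w (ρ • y) ∂(unitSphereMeasure m)) ^ 2
      ∂(unitSphereMeasure m)) := by
  rw [sDev, setAverage_sphere_eq hm hρ, sAvg, setAverage_sphere_eq hm hρ]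

lemma unitSphereMeasure_eq_zero (h : μH[(m : ℝ) - 1] (sphere (0 : E m) 1) = 0
    ∨ μH[(m : ℝ) - 1] (sphere (0 : E m) 1) = ∞) : unitSphereMeasure m = 0 := by
  rcases h with h | h
  · rw [unitSphereMeasure, Measure.restrict_eq_zero.2 h, smul_zero]
  · rw [unitSphereMeasure, h, ENNReal.inv_top, zero_smul]

lemma isRotInvSphere_unitSphereMeasure (h0 : μH[(m : ℝ) - 1] (sphere (0 : E m) 1) ≠ 0)
    (htop : μH[(m : ℝ) - 1] (sphere (0 : E m) 1) ≠ ∞) : IsRotInvSphere (unitSphereMeasure m) where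
  isProb := ⟨by
    rw [unitSphereMeasure, Measure.smul_apply, Measure.restrict_apply_univ, smul_eq_mul,
      ENNReal.inv_mul_cancel h0 htop]⟩
  ae_mem := Measure.ae_smul_measure (ae_restrict_mem isClosed_sphere.measurableSet) _
  map_eq e := by
    have h := (e.toIsometryEquiv.measurePreserving_hausdorffMeasure ((m : ℝ) - 1)).restrict_preimage
      (isClosed_sphere (x := (0 : E m)) (ε := 1)).measurableSet
    have hpre : e.toIsometryEquiv ⁻¹' sphere (0 : E m) 1 = sphere 0 1 := by
      ext x
      simp
    rw [hpre] at h
    exact h.smul_measure _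

end SphereMeasure

/-- Lemma 6.2 (decay of spherical oscillations for the homogeneous reduced equation). -/
theorem homogeneous_oscillation_decay (m : ℕ) (hm : 1 ≤ m) (γ ε R0 : ℝ)
    (hγ : 0 < γ) (hε : 0 < ε) (hR0 : 0 < R0) (v1 : E m → ℝ)
    (hv1 : ContDiffOn ℝ 2 v1 (ball (0 : E m) R0))
    (hv1c : ContinuousOn v1 (closure (ball (0 : E m) R0)))
    (hpde : ∀ y ∈ ball (0 : E m) R0,
      (ε + ‖y‖^2) * elap v1 y + 2 * ⟪y, gradient v1 y⟫ - (2/γ) * v1 y = 0) :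
    ∀ ρ R : ℝ, 0 < ρ → ρ < R → R ≤ R0 →
      sDev ρ v1 ≤
        (ρ/R) ^ (min ((-(m:ℝ) + Real.sqrt ((m:ℝ)^2 + 4*((m:ℝ) - 1 + 2/γ)))/2) 1) *
          sDev R v1 := by
  intro ρ R hρ hρR hR
  have hRpos := hρ.trans hρR
  rw [sDev_eq hm hρ, sDev_eq hm hRpos]
  by_cases hS : μH[(m : ℝ) - 1] (sphere (0 : E m) 1) = 0
    ∨ μH[(m : ℝ) - 1] (sphere (0 : E m) 1) = ∞
  · simp [unitSphereMeasure_eq_zero hS]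
  rw [not_or] at hS
  have hν := isRotInvSphere_unitSphereMeasure hS.1 hS.2
  have hcont : ∀ r, 0 < r → r ≤ R0 → ContinuousOn (fun x : E m => v1 (r • x)) (sphere 0 1) :=
    fun r hr hrR => hv1c.comp (by fun_prop) fun x hx => by
      rw [closure_ball _ hR0.ne', mem_closedBall_zero_iff, norm_smul, mem_sphere_zero_iff_norm.1 hx,
        mul_one, Real.norm_of_nonneg hr.le]
      exact hrR
  have hq : 0 ≤ (ρ / R) ^
      (min ((-(m:ℝ) + Real.sqrt ((m:ℝ)^2 + 4*((m:ℝ) - 1 + 2/γ)))/2) 1) := by positivity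
  refine hν.sqrt_variance_le (hcont ρ hρ (hρR.le.trans hR)) (by positivity) fun p hp => ?_
  rw [mul_assoc]
  exact hν.abs_integral_mul_polyFun_le hm hq (hcont ρ hρ (hρR.le.trans hR)) (hcont R hRpos hR)
    (fun p lam hlam hpl hp0 =>
      hν.integral_smul_mul_eigen_decay hm hγ hε hR0 hv1 hv1c hpde hlam hpl hp0 hρ hρR hR) _ hp
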